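/- Let E, T, C, W be positive reals. Define b* = (1/W)·(E T²/C)^{1/3} and f* = (E/(C T))^{1/3}. Then (b*, f*) is feasible with both constraints tight, i.e., b* C W (f*)² = E and b* W / f* = T; and for every pair of positive reals (b, f) satisfying b C W f² ≤ E and b W / f ≤ T, one has b ≤ b*. Hence (b*, f*) maximizes the mini-batch size b over all feasible pairs. -/

import Mathlib

theorem Real.rpow_one_third_pow_three {x : ℝ} (hx : 0 ≤ x) : (x ^ ((1 : ℝ) / 3)) ^ 3 = x := by
  rw [← Real.rpow_natCast, ← Real.rpow_mul hx]
  norm_num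

/-- **Lemma 4** (optimal local-computation policy).  Under the energy constraint
`b·C·W·f² ≤ E` and latency constraint `b·W/f ≤ T`, the pair
`b* = (1/W)(E T²/C)^{1/3}`, `f* = (E/(C T))^{1/3}` is feasible with both constraints tight, and
any feasible pair `(b, f)` of positive reals satisfies `b ≤ b*`; hence `(b*, f*)` maximizes the
mini-batch size. -/
theorem optimal_local_computation_policy
    (E T C W : ℝ) (hE : 0 < E) (hT : 0 < T) (hC : 0 < C) (hW : 0 < W)
    (bstar fstar : ℝ)
    (hb : bstar = (1 / W) * (E * T ^ 2 / C) ^ ((1 : ℝ) / 3))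
    (hf : fstar = (E / (C * T)) ^ ((1 : ℝ) / 3)) :
    (bstar * C * W * fstar ^ 2 = E ∧ bstar * W / fstar = T) ∧
      ∀ b f : ℝ, 0 < b → 0 < f → b * C * W * f ^ 2 ≤ E → b * W / f ≤ T → b ≤ bstar := by
  have hf_pos : 0 < fstar := hf ▸ by positivity
  have hf_cube : fstar ^ 3 = E / (C * T) := hf ▸ Real.rpow_one_third_pow_three (by positivity)
  have hb_pos : 0 < bstar := hb ▸ by positivity
  have hb_cube : (bstar * W) ^ 3 = E * T ^ 2 / C := by
    have hbW : bstar * W = (E * T ^ 2 / C) ^ ((1 : ℝ) / 3) := by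
      rw [hb]
      field_simp
    rw [hbW, Real.rpow_one_third_pow_three (by positivity)]
  have hbf : bstar * W = T * fstar := by
    refine (pow_left_inj₀ (by positivity) (by positivity) three_ne_zero).1 ?_
    rw [hb_cube, mul_pow, hf_cube]
    field_simp
  refine ⟨⟨?_, ?_⟩, fun b f hb0 hf0 henergy hlatency => ?_⟩
  · calc bstar * C * W * fstar ^ 2 = (bstar * W) * C * fstar ^ 2 := by ring
      _ = T * C * fstar ^ 3 := by rw [hbf]; ring
      _ = E := by rw [hf_cube]; field_simp
  · rw [hbf]
    field_simp
  · rw [div_le_iff₀ hf0] at hlatency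
    refine le_of_mul_le_mul_right ?_ hW
    refine le_of_pow_le_pow_left₀ three_ne_zero (by positivity) ?_
    rw [hb_cube, le_div_iff₀ hC]
    calc (b * W) ^ 3 * C = b * W * C * (b * W) ^ 2 := by ring
      _ ≤ b * W * C * (T * f) ^ 2 := by gcongr
      _ = b * C * W * f ^ 2 * T ^ 2 := by ring
      _ ≤ E * T ^ 2 := by gcongr
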